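/- Let X and Y be random variables with values in separable metric spaces (𝒳, d) and (𝒴, d) respectively, set Z := (X, Y), θ := L(Z), μ := L(X), ν := L(Y), and let θₙ denote the empirical measure of Z₁, ..., Zₙ, where (Z_k)_{k∈ℕ} is a strictly stationary and ergodic sequence with L(Z₁) = θ. If X and Y have finite first moments, i.e. E d(X, x₀) < ∞ and E d(Y, y₀) < ∞ for some fixed points x₀ ∈ 𝒳, y₀ ∈ 𝒴, then dcov(θₙ) → dcov(θ) almost surely as n → ∞. -/

import Mathlib

open MeasureTheory Filter Topology
open scoped ENNReal

noncomputable section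

/-- The shift map on path space. -/
def shift {𝒵 : Type*} (x : ℕ → 𝒵) : ℕ → 𝒵 := fun i => x (i + 1)

/-- Empirical measure of `Z₁, …, Zₙ` (indexed here as `Z 0, …, Z (n-1)`). -/
def emp {Ω 𝒵 : Type*} [MeasurableSpace 𝒵] (Z : ℕ → Ω → 𝒵) (n : ℕ) (ω : Ω) : Measure 𝒵 :=
  (n : ℝ≥0∞)⁻¹ • ∑ k ∈ Finset.range n, Measure.dirac (Z k ω)

/-- `a_μ(x) = ∫ ρ(x,x') dμ(x')`. -/
def aM {X : Type*} [MeasurableSpace X] (ρ : X → X → ℝ) (μ : Measure X) (x : X) : ℝ :=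
  ∫ x', ρ x x' ∂μ

/-- `D(μ) = ∫ ρ(x,x') dμ²(x,x')`. -/
def DM {X : Type*} [MeasurableSpace X] (ρ : X → X → ℝ) (μ : Measure X) : ℝ :=
  ∫ p : X × X, ρ p.1 p.2 ∂(μ.prod μ)

/-- `d_μ(x,x') = ρ(x,x') - a_μ(x) - a_μ(x') + D(μ)`. -/
def dM {X : Type*} [MeasurableSpace X] (ρ : X → X → ℝ) (μ : Measure X) (x x' : X) : ℝ :=
  ρ x x' - aM ρ μ x - aM ρ μ x' + DM ρ μ

/-- `δ_θ(z,z') = d_μ(x,x') d_ν(y,y')` where `μ, ν` are the marginals of `θ`. -/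
def deltaTheta {X Y : Type*} [MeasurableSpace X] [MeasurableSpace Y]
    (ρX : X → X → ℝ) (ρY : Y → Y → ℝ) (θ : Measure (X × Y)) (z z' : X × Y) : ℝ :=
  dM ρX (θ.map Prod.fst) z.1 z'.1 * dM ρY (θ.map Prod.snd) z.2 z'.2

/-- The distance covariance `dcov(θ) = ∫ δ_θ dθ²`. -/
def dcov {X Y : Type*} [MeasurableSpace X] [MeasurableSpace Y]
    (ρX : X → X → ℝ) (ρY : Y → Y → ℝ) (θ : Measure (X × Y)) : ℝ :=
  ∫ p : (X × Y) × (X × Y), deltaTheta ρX ρY θ p.1 p.2 ∂(θ.prod θ)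

set_option linter.unusedSectionVars false

/-- Running maxima of Birkhoff sums. -/
def bmax {α : Type*} (T : α → α) (g : α → ℝ) : ℕ → α → ℝ
  | 0, x => g x
  | n + 1, x => g x + max 0 (bmax T g n (T x))

lemma bmax_mono_succ {α : Type*} (T : α → α) (g : α → ℝ) (n : ℕ) :
    ∀ x, bmax T g n x ≤ bmax T g (n + 1) x := by
  induction n with
  | zero => intro x; simp [bmax]
  | succ n ih =>
    intro x
    have := ih (T x)
    rw [bmax, bmax]
    gcongr

lemma bmax_monotone {α : Type*} (T : α → α) (g : α → ℝ) (x : α) :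
    Monotone fun n => bmax T g n x :=
  monotone_nat_of_le_succ fun n => bmax_mono_succ T g n x

lemma birkhoffSum_le_bmax {α : Type*} (T : α → α) (g : α → ℝ) (n : ℕ) :
    ∀ x, birkhoffSum T g (n + 1) x ≤ bmax T g n x := by
  induction n with
  | zero => intro x; simp [bmax]
  | succ n ih =>
    intro x
    have := ih (T x)
    rw [birkhoffSum_succ', bmax]
    gcongr
    exact this.trans (le_max_right _ _)

lemma bmax_measurable {α : Type*} [MeasurableSpace α] {T : α → α} {g : α → ℝ}
    (hT : Measurable T) (hg : Measurable g) (n : ℕ) : Measurable (bmax T g n) := by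
  induction n with
  | zero => exact hg
  | succ n ih => exact hg.add (measurable_const.max (ih.comp hT))

lemma bmax_integrable {α : Type*} [MeasurableSpace α] {μ : Measure α} [IsProbabilityMeasure μ]
    {T : α → α} {g : α → ℝ}
    (hT : MeasurePreserving T μ μ) (hgi : Integrable g μ) (n : ℕ) :
    Integrable (bmax T g n) μ := by
  induction n with
  | zero => exact hgi
  | succ n ih =>
    have h1 : Integrable (fun x => bmax T g n (T x)) μ := hT.integrable_comp_of_integrable ih
    exact hgi.add ((integrable_zero _ _ _).sup h1)

lemma ergodic_bdd {α : Type*} [MeasurableSpace α] {μ : Measure α} [IsProbabilityMeasure μ]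
    {T : α → α} {g : α → ℝ} (hT : Ergodic T μ) (hg : Measurable g) (hgi : Integrable g μ)
    (hneg : ∫ x, g x ∂μ < 0) :
    ∀ᵐ x ∂μ, ∃ K : ℕ, ∀ n, birkhoffSum T g (n + 1) x ≤ K := by
  set A : Set α := {x | ∀ K : ℕ, ∃ n, (K : ℝ) < bmax T g n x} with hA
  have hTm : Measurable T := hT.measurable
  have hMm := bmax_measurable hTm hg
  have hAm : MeasurableSet A := by
    have : A = ⋂ K : ℕ, ⋃ n, {x | (K : ℝ) < bmax T g n x} := by ext x; simp [hA]
    rw [this]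
    exact MeasurableSet.iInter fun K => MeasurableSet.iUnion fun n =>
      measurableSet_lt measurable_const (hMm n)
  have hinv : T ⁻¹' A = A := by
    ext x
    simp only [hA, Set.mem_preimage, Set.mem_ofPred_eq]
    constructor
    · intro h K
      obtain ⟨K', hK'⟩ := exists_nat_gt ((K : ℝ) - g x)
      obtain ⟨n, hn⟩ := h K'
      refine ⟨n + 1, ?_⟩
      rw [bmax]
      have := le_max_right 0 (bmax T g n (T x))
      linarith
    · intro h K
      obtain ⟨K', hK'⟩ := exists_nat_gt ((K : ℝ) + g x)
      obtain ⟨n, hn⟩ := h K'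
      refine ⟨n, ?_⟩
      have h2 := hn.trans_le (bmax_mono_succ T g n x)
      rw [bmax] at h2
      have h3 : (K : ℝ) < max 0 (bmax T g n (T x)) := by linarith
      rcases lt_max_iff.1 h3 with h4 | h4
      · exact absurd h4 (not_lt.2 (Nat.cast_nonneg K))
      · exact h4
  rcases hT.toPreErgodic.ae_mem_or_ae_notMem hAm hinv with h | h
  · exfalso
    have hint := bmax_integrable hT.toMeasurePreserving hgi
    have hintT : ∀ n, Integrable (fun x => bmax T g n (T x)) μ := fun n =>
      hT.toMeasurePreserving.integrable_comp_of_integrable (hint n)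
    have hgT : Integrable (fun x => |g (T x)|) μ :=
      (hT.toMeasurePreserving.integrable_comp_of_integrable hgi).abs
    have hlim : Tendsto (fun n => ∫ x, max 0 (-bmax T g n (T x)) ∂μ) atTop (𝓝 (∫ x, (0:ℝ) ∂μ)) := by
      refine tendsto_integral_of_dominated_convergence (fun x => |g (T x)|) ?_ hgT ?_ ?_
      · intro n
        exact (measurable_const.max ((hMm n).comp hTm).neg).aestronglyMeasurable
      · intro n
        refine ae_of_all _ fun x => ?_
        rw [Real.norm_of_nonneg (le_max_left _ _)]
        refine max_le (abs_nonneg _) ?_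
        have h1 : g (T x) ≤ bmax T g n (T x) := bmax_monotone T g (T x) (Nat.zero_le n)
        have := neg_abs_le (g (T x))
        linarith
      · filter_upwards [h] with x hx
        have hx' : T x ∈ A := by rw [← hinv] at hx; exact hx
        obtain ⟨N, hN⟩ := hx' 0
        refine tendsto_const_nhds.congr' ?_
        filter_upwards [eventually_ge_atTop N] with n hn
        have h2 := bmax_monotone T g (T x) hn
        simp only [Nat.cast_zero] at hN h2
        rw [max_eq_left]
        linarith
    rw [integral_zero] at hlim
    have hge : ∀ n, 0 ≤ ∫ x, g x ∂μ + ∫ x, max 0 (-bmax T g n (T x)) ∂μ := by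
      intro n
      have hi : Integrable (fun x => max 0 (-bmax T g n (T x))) μ :=
        (integrable_zero _ _ _).sup (hintT n).neg
      have e1 : ∫ x, bmax T g n (T x) ∂μ = ∫ x, bmax T g n x ∂μ := by
        have h5 := integral_map (μ := μ) hTm.aemeasurable
          (f := bmax T g n) ((hMm n).aestronglyMeasurable)
        rw [hT.toMeasurePreserving.map_eq] at h5
        exact h5.symm
      have e2 : ∫ x, bmax T g n x ∂μ ≤ ∫ x, bmax T g (n+1) x ∂μ :=
        integral_mono (hint n) (hint (n+1)) (bmax_mono_succ T g n)
      have e3 : ∫ x, bmax T g (n+1) x ∂μ =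
          ∫ x, g x ∂μ + ∫ x, max 0 (-bmax T g n (T x)) ∂μ + ∫ x, bmax T g n (T x) ∂μ := by
        have hgh : Integrable (fun x => g x + max 0 (-bmax T g n (T x))) μ := hgi.add hi
        rw [← integral_add hgi hi, ← integral_add hgh (hintT n)]
        refine integral_congr_ae (ae_of_all _ fun x => ?_)
        simp only [bmax]
        rcases le_total 0 (bmax T g n (T x)) with h6 | h6
        · rw [max_eq_right h6, max_eq_left (by linarith)]; ring
        · rw [max_eq_left h6, max_eq_right (by linarith)]; ring
      linarith
    have := ge_of_tendsto' (hlim.const_add (∫ x, g x ∂μ)) hge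
    linarith
  · filter_upwards [h] with x hx
    simp only [hA, Set.mem_ofPred_eq, not_forall, not_exists, not_lt] at hx
    obtain ⟨K, hK⟩ := hx
    exact ⟨K, fun n => (birkhoffSum_le_bmax T g n x).trans (hK n)⟩

lemma birkhoff_upper {α : Type*} [MeasurableSpace α] {μ : Measure α} [IsProbabilityMeasure μ]
    {T : α → α} {g : α → ℝ} (hT : Ergodic T μ) (hg : Measurable g) (hgi : Integrable g μ) :
    ∀ᵐ x ∂μ, ∀ m : ℕ, ∀ᶠ n : ℕ in atTop,
      (n : ℝ)⁻¹ * birkhoffSum T g n x ≤ ∫ x, g x ∂μ + 2 / ((m : ℝ) + 1) := by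
  rw [ae_all_iff]
  intro m
  set ε : ℝ := 1 / ((m : ℝ) + 1) with hε
  have hεpos : 0 < ε := by positivity
  set c := ∫ x, g x ∂μ + ε with hc
  have h := ergodic_bdd (g := fun x => g x - c) hT (hg.sub measurable_const)
    (hgi.sub (integrable_const _)) (by
      rw [integral_sub hgi (integrable_const _)]; simp; linarith)
  filter_upwards [h] with x hx
  obtain ⟨K, hK⟩ := hx
  obtain ⟨N, hN⟩ := exists_nat_gt ((K : ℝ) / ε)
  filter_upwards [eventually_ge_atTop (N + 1)] with n hn
  obtain ⟨k, rfl⟩ : ∃ k, n = k + 1 := ⟨n - 1, by omega⟩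
  have h1 := hK k
  have h2 : birkhoffSum T (fun x => g x - c) (k+1) x =
      birkhoffSum T g (k+1) x - ((k + 1 : ℕ) : ℝ) * c := by
    simp [birkhoffSum, Finset.sum_sub_distrib]
  rw [h2] at h1
  have hpos : (0 : ℝ) < ((k + 1 : ℕ) : ℝ) := by positivity
  have h3 : (K : ℝ) < N * ε := by rwa [div_lt_iff₀ hεpos] at hN
  have h4 : (N : ℝ) ≤ ((k + 1 : ℕ) : ℝ) := by exact_mod_cast (by omega)
  have h5 : (N : ℝ) * ε ≤ ((k + 1 : ℕ) : ℝ) * ε := by gcongr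
  have h6 : ∫ x, g x ∂μ + 2 / ((m : ℝ) + 1) = c + ε := by rw [hc, hε]; ring
  rw [h6, inv_mul_le_iff₀ hpos]
  linarith

lemma birkhoff_ergodic {α : Type*} [MeasurableSpace α] {μ : Measure α} [IsProbabilityMeasure μ]
    {T : α → α} {g : α → ℝ} (hT : Ergodic T μ) (hg : Measurable g) (hgi : Integrable g μ) :
    ∀ᵐ x ∂μ, Tendsto (fun n : ℕ => (n : ℝ)⁻¹ * birkhoffSum T g n x) atTop
      (𝓝 (∫ x, g x ∂μ)) := by
  filter_upwards [birkhoff_upper hT hg hgi, birkhoff_upper hT hg.neg hgi.neg] with x h1 h2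
  rw [Metric.tendsto_nhds]
  intro ε hε
  obtain ⟨m, hm⟩ := exists_nat_one_div_lt (half_pos hε)
  have hm' : 2 / ((m : ℝ) + 1) < ε := by
    have : 2 / ((m : ℝ) + 1) = 2 * (1 / ((m : ℝ) + 1)) := by ring
    linarith
  filter_upwards [h1 m, h2 m] with n h3 h4
  rw [birkhoffSum_neg, Pi.neg_def, integral_neg] at h4
  rw [Real.dist_eq, abs_lt]
  constructor <;> linarith

/-- A measurable semimetric with an integrable envelope. -/
structure Ker {X : Type*} [MeasurableSpace X] (ρ : X → X → ℝ) (h : X → ℝ) (μ : Measure X) :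
    Prop where
  meas : Measurable (fun p : X × X => ρ p.1 p.2)
  nonneg : ∀ x x', 0 ≤ ρ x x'
  symm : ∀ x x', ρ x x' = ρ x' x
  tri : ∀ x y z, ρ x z ≤ ρ x y + ρ y z
  int : Integrable h μ
  le : ∀ x x', ρ x x' ≤ h x + h x'

section ker
variable {X : Type*} [MeasurableSpace X] {ρ : X → X → ℝ} {h : X → ℝ} {μ : Measure X}
  [IsProbabilityMeasure μ]

lemma Ker.int1 (K : Ker ρ h μ) (x : X) : Integrable (fun x' => ρ x x') μ := by
  refine ((integrable_const (h x)).add K.int).mono'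
    (K.meas.comp measurable_prodMk_left).aestronglyMeasurable (ae_of_all _ fun x' => ?_)
  rw [Real.norm_of_nonneg (K.nonneg _ _)]
  exact K.le x x'

lemma Ker.int2 (K : Ker ρ h μ) : Integrable (fun p : X × X => ρ p.1 p.2) (μ.prod μ) := by
  refine ((K.int.comp_fst μ).add (K.int.comp_snd μ)).mono'
    K.meas.aestronglyMeasurable (ae_of_all _ fun p => ?_)
  rw [Real.norm_of_nonneg (K.nonneg _ _)]
  exact K.le p.1 p.2

lemma Ker.DM_eq (K : Ker ρ h μ) : DM ρ μ = ∫ x, aM ρ μ x ∂μ := by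
  unfold DM aM
  rw [integral_prod _ K.int2]

lemma Ker.aM_int (K : Ker ρ h μ) : Integrable (aM ρ μ) μ := K.int2.integral_prod_left

lemma Ker.aM_meas (K : Ker ρ h μ) : Measurable (aM ρ μ) :=
  (StronglyMeasurable.integral_prod_right (f := ρ) K.meas.stronglyMeasurable).measurable

lemma Ker.aM_nonneg (K : Ker ρ h μ) (x : X) : 0 ≤ aM ρ μ x := integral_nonneg fun _ => K.nonneg _ _

lemma Ker.DM_nonneg (K : Ker ρ h μ) : 0 ≤ DM ρ μ := integral_nonneg fun _ => K.nonneg _ _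

lemma Ker.DM_le (K : Ker ρ h μ) : DM ρ μ ≤ 2 * ∫ x, h x ∂μ := by
  have h1 : DM ρ μ ≤ ∫ p : X × X, h p.1 + h p.2 ∂(μ.prod μ) :=
    integral_mono K.int2 ((K.int.comp_fst μ).add (K.int.comp_snd μ)) fun p => K.le p.1 p.2
  rw [integral_add (K.int.comp_fst μ) (K.int.comp_snd μ), integral_fun_fst, integral_fun_snd] at h1
  simp at h1
  linarith

lemma Ker.aM_tri (K : Ker ρ h μ) (x x' : X) : aM ρ μ x ≤ ρ x x' + aM ρ μ x' := by
  have h1 : aM ρ μ x ≤ ∫ y, ρ x x' + ρ x' y ∂μ :=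
    integral_mono (K.int1 x) ((integrable_const _).add (K.int1 x')) fun y => K.tri x x' y
  rw [integral_add (integrable_const _) (K.int1 x')] at h1
  simpa [aM] using h1

lemma Ker.le_aM (K : Ker ρ h μ) (x x' : X) : ρ x x' ≤ aM ρ μ x + aM ρ μ x' := by
  have h1 : ∫ y, ρ x x' ∂μ ≤ ∫ y, ρ x y + ρ x' y ∂μ :=
    integral_mono (integrable_const _) ((K.int1 x).add (K.int1 x')) fun y => by
      have := K.tri x y x'
      rw [K.symm y x'] at this
      exact this
  rw [integral_add (K.int1 x) (K.int1 x')] at h1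
  simpa [aM] using h1

lemma Ker.DM_le_aM (K : Ker ρ h μ) (x : X) : DM ρ μ ≤ 2 * aM ρ μ x := by
  rw [K.DM_eq]
  have h1 : ∫ y, aM ρ μ y ∂μ ≤ ∫ y, ρ x y + aM ρ μ x ∂μ :=
    integral_mono K.aM_int ((K.int1 x).add (integrable_const _)) fun y => by
      have := K.aM_tri y x
      rwa [K.symm y x] at this
  rw [integral_add (K.int1 x) (integrable_const _)] at h1
  have h2 : ∫ y, ρ x y ∂μ = aM ρ μ x := rfl
  rw [h2] at h1
  simp at h1
  linarith

lemma Ker.abs_dM_le (K : Ker ρ h μ) (x x' : X) : |dM ρ μ x x'| ≤ 2 * aM ρ μ x := by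
  have h1 := K.le_aM x x'
  have h2 := K.aM_tri x' x
  rw [K.symm x' x] at h2
  have h3 := K.DM_le_aM x
  have h4 := K.DM_nonneg
  unfold dM
  rw [abs_le]
  constructor <;> linarith

lemma Ker.abs_dM_le' (K : Ker ρ h μ) (x x' : X) : |dM ρ μ x x'| ≤ 2 * aM ρ μ x' := by
  have : dM ρ μ x x' = dM ρ μ x' x := by unfold dM; rw [K.symm x x']; ring
  rw [this]
  exact K.abs_dM_le x' x

lemma Ker.dM_meas (K : Ker ρ h μ) : Measurable (fun p : X × X => dM ρ μ p.1 p.2) := by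
  unfold dM
  exact (((K.meas.sub (K.aM_meas.comp measurable_fst)).sub
    (K.aM_meas.comp measurable_snd)).add measurable_const)

lemma Ker.dM_diff {ρ' : X → X → ℝ} {h' r : X → ℝ} (K : Ker ρ h μ) (K' : Ker ρ' h' μ)
    (hr : Integrable r μ) (hd : ∀ x x', |ρ x x' - ρ' x x'| ≤ r x + r x') (x x' : X) :
    |dM ρ μ x x' - dM ρ' μ x x'| ≤ 2 * r x + 2 * r x' + 4 * ∫ y, r y ∂μ := by
  have ha : ∀ x, |aM ρ μ x - aM ρ' μ x| ≤ r x + ∫ y, r y ∂μ := by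
    intro x
    unfold aM
    rw [← integral_sub (K.int1 x) (K'.int1 x)]
    refine abs_integral_le_integral_abs.trans ?_
    have h1 : ∫ y, |ρ x y - ρ' x y| ∂μ ≤ ∫ y, r x + r y ∂μ :=
      integral_mono ((K.int1 x).sub (K'.int1 x)).abs ((integrable_const _).add hr) fun y => hd x y
    rw [integral_add (integrable_const _) hr] at h1
    simpa using h1
  have hD : |DM ρ μ - DM ρ' μ| ≤ 2 * ∫ y, r y ∂μ := by
    rw [K.DM_eq, K'.DM_eq, ← integral_sub K.aM_int K'.aM_int]
    refine abs_integral_le_integral_abs.trans ?_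
    have h1 : ∫ y, |aM ρ μ y - aM ρ' μ y| ∂μ ≤ ∫ y, r y + ∫ y, r y ∂μ ∂μ :=
      integral_mono (K.aM_int.sub K'.aM_int).abs (hr.add (integrable_const _)) fun y => ha y
    rw [integral_add hr (integrable_const _)] at h1
    simp at h1
    linarith
  have h1 := abs_le.1 (hd x x')
  have h2 := abs_le.1 (ha x)
  have h3 := abs_le.1 (ha x')
  have h4 := abs_le.1 hD
  unfold dM
  rw [abs_le]
  constructor <;> linarith

end ker

section stab
variable {X Y : Type*} [MeasurableSpace X] [MeasurableSpace Y]

lemma integral_le_prods {Z : Type*} [MeasurableSpace Z] (θ : Measure Z) [IsProbabilityMeasure θ]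
    {a s b r : Z → ℝ} (ha : Integrable a θ) (hs : Integrable s θ) (hb : Integrable b θ)
    (hr : Integrable r θ) {F : Z × Z → ℝ}
    (hF : ∀ p, |F p| ≤ 4 * (a p.1 * s p.2) + 4 * (s p.1 * a p.2) + 8 * (a p.1 * ∫ z, s z ∂θ)
      + 4 * (b p.1 * r p.2) + 4 * (r p.1 * b p.2) + 8 * (b p.1 * ∫ z, r z ∂θ)) :
    |∫ p, F p ∂(θ.prod θ)| ≤ 16 * ((∫ z, a z ∂θ) * ∫ z, s z ∂θ)
      + 16 * ((∫ z, b z ∂θ) * ∫ z, r z ∂θ) := by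
  have i1 := (ha.mul_prod hs).const_mul 4
  have i2 := (hs.mul_prod ha).const_mul 4
  have i3 := (ha.mul_prod (integrable_const (μ := θ) (∫ z, s z ∂θ))).const_mul 8
  have i4 := (hb.mul_prod hr).const_mul 4
  have i5 := (hr.mul_prod hb).const_mul 4
  have i6 := (hb.mul_prod (integrable_const (μ := θ) (∫ z, r z ∂θ))).const_mul 8
  have j2 := i1.add i2
  have j3 := j2.add i3
  have j4 := j3.add i4
  have j5 := j4.add i5
  have j6 := j5.add i6
  refine (norm_integral_le_of_norm_le (f := F) j6 (ae_of_all _ fun p => hF p)).trans (le_of_eq ?_)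
  rw [integral_add' j5 i6, integral_add' j4 i5, integral_add' j3 i4, integral_add' j2 i3,
    integral_add' i1 i2]
  simp only [integral_const_mul]
  rw [integral_prod_mul a s, integral_prod_mul s a, integral_prod_mul a (fun _ => ∫ z, s z ∂θ),
    integral_prod_mul b r, integral_prod_mul r b, integral_prod_mul b (fun _ => ∫ z, r z ∂θ)]
  simp
  ring

variable {θ : Measure (X × Y)} [IsProbabilityMeasure θ]

lemma delta_int {ρ : X → X → ℝ} {h : X → ℝ} {σ : Y → Y → ℝ} {k : Y → ℝ}
    (K : Ker ρ h (θ.map Prod.fst)) (L : Ker σ k (θ.map Prod.snd)) :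
    Integrable (fun p : (X × Y) × (X × Y) => deltaTheta ρ σ θ p.1 p.2) (θ.prod θ) := by
  have : IsProbabilityMeasure (θ.map Prod.fst) := Measure.isProbabilityMeasure_map (by fun_prop)
  have : IsProbabilityMeasure (θ.map Prod.snd) := Measure.isProbabilityMeasure_map (by fun_prop)
  have i1 : Integrable (fun z : X × Y => aM ρ (θ.map Prod.fst) z.1) θ :=
    K.aM_int.comp_measurable measurable_fst
  have i2 : Integrable (fun z : X × Y => aM σ (θ.map Prod.snd) z.2) θ :=
    L.aM_int.comp_measurable measurable_snd
  refine ((i1.mul_prod i2).const_mul 4).mono' ?_ (ae_of_all _ fun p => ?_)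
  · unfold deltaTheta
    have m1 := K.dM_meas.comp
      (show Measurable (fun p : (X × Y) × (X × Y) => (p.1.1, p.2.1)) by fun_prop)
    have m2 := L.dM_meas.comp
      (show Measurable (fun p : (X × Y) × (X × Y) => (p.1.2, p.2.2)) by fun_prop)
    exact (m1.mul m2).aestronglyMeasurable
  · unfold deltaTheta
    rw [norm_mul, Real.norm_eq_abs, Real.norm_eq_abs]
    have := mul_le_mul (K.abs_dM_le p.1.1 p.2.1) (L.abs_dM_le' p.1.2 p.2.2) (abs_nonneg _)
      (by have := K.aM_nonneg p.1.1; linarith)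
    linarith

lemma dcov_stab {ρ ρ' : X → X → ℝ} {h h' r : X → ℝ} {σ σ' : Y → Y → ℝ} {k k' s : Y → ℝ}
    (K : Ker ρ h (θ.map Prod.fst)) (L : Ker σ k (θ.map Prod.snd))
    (K' : Ker ρ' h' (θ.map Prod.fst)) (L' : Ker σ' k' (θ.map Prod.snd))
    (hr : Integrable r (θ.map Prod.fst)) (hs : Integrable s (θ.map Prod.snd))
    (hr0 : ∀ x, 0 ≤ r x) (hs0 : ∀ x, 0 ≤ s x)
    (hd : ∀ x x', |ρ x x' - ρ' x x'| ≤ r x + r x')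
    (he : ∀ x x', |σ x x' - σ' x x'| ≤ s x + s x') :
    |dcov ρ σ θ - dcov ρ' σ' θ| ≤
      32 * ((∫ z, h z.1 ∂θ) * ∫ z, s z.2 ∂θ) + 32 * ((∫ z, k' z.2 ∂θ) * ∫ z, r z.1 ∂θ) := by
  have : IsProbabilityMeasure (θ.map Prod.fst) := Measure.isProbabilityMeasure_map (by fun_prop)
  have : IsProbabilityMeasure (θ.map Prod.snd) := Measure.isProbabilityMeasure_map (by fun_prop)
  have mapX : ∀ f : X → ℝ, Integrable f (θ.map Prod.fst) →
      ∫ x, f x ∂(θ.map Prod.fst) = ∫ z, f z.1 ∂θ := fun f hf =>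
    integral_map (by fun_prop) hf.aestronglyMeasurable
  have mapY : ∀ f : Y → ℝ, Integrable f (θ.map Prod.snd) →
      ∫ x, f x ∂(θ.map Prod.snd) = ∫ z, f z.2 ∂θ := fun f hf =>
    integral_map (by fun_prop) hf.aestronglyMeasurable
  have DK : ∫ z, aM ρ (θ.map Prod.fst) z.1 ∂θ ≤ 2 * ∫ z, h z.1 ∂θ := by
    rw [← mapX _ K.aM_int, ← mapX _ K.int, ← K.DM_eq]
    exact K.DM_le
  have DL : ∫ z, aM σ' (θ.map Prod.snd) z.2 ∂θ ≤ 2 * ∫ z, k' z.2 ∂θ := by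
    rw [← mapY _ L'.aM_int, ← mapY _ L'.int, ← L'.DM_eq]
    exact L'.DM_le
  have hR : 0 ≤ ∫ z, r z.1 ∂θ := integral_nonneg fun z => hr0 _
  have hS : 0 ≤ ∫ z, s z.2 ∂θ := integral_nonneg fun z => hs0 _
  have key := integral_le_prods θ (a := fun z => aM ρ (θ.map Prod.fst) z.1) (s := fun z => s z.2)
    (b := fun z => aM σ' (θ.map Prod.snd) z.2) (r := fun z => r z.1)
    (F := fun p => deltaTheta ρ σ θ p.1 p.2 - deltaTheta ρ' σ' θ p.1 p.2)
    (K.aM_int.comp_measurable measurable_fst) (hs.comp_measurable measurable_snd)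
    (L'.aM_int.comp_measurable measurable_snd) (hr.comp_measurable measurable_fst) (by
      rintro ⟨⟨x, y⟩, ⟨x', y'⟩⟩
      have d1 := K.dM_diff K' hr hd x x'
      have d2 := L.dM_diff L' hs he y y'
      rw [mapX _ hr] at d1
      rw [mapY _ hs] at d2
      have b1 := K.abs_dM_le x x'
      have b2 := K.abs_dM_le' x x'
      have c1 := L'.abs_dM_le y y'
      have c2 := L'.abs_dM_le' y y'
      simp only [deltaTheta]
      generalize dM ρ (θ.map Prod.fst) x x' = A at *
      generalize dM ρ' (θ.map Prod.fst) x x' = A' at *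
      generalize dM σ (θ.map Prod.snd) y y' = B at *
      generalize dM σ' (θ.map Prod.snd) y y' = B' at *
      generalize ∫ z : X × Y, r z.1 ∂θ = R at *
      generalize ∫ z : X × Y, s z.2 ∂θ = S at *
      have e : A * B - A' * B' = A * (B - B') + (A - A') * B' := by ring
      have e1 : |A * B - A' * B'| ≤ |A| * |B - B'| + |A - A'| * |B'| := by
        rw [e, ← abs_mul, ← abs_mul]; exact abs_add_le _ _
      have f1 := mul_le_mul_of_nonneg_left d2 (abs_nonneg A)
      have f2 := mul_le_mul_of_nonneg_right d1 (abs_nonneg B')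
      have g1 := mul_le_mul_of_nonneg_right b2 (hs0 y)
      have g2 := mul_le_mul_of_nonneg_right b1 (hs0 y')
      have g3 := mul_le_mul_of_nonneg_right b1 hS
      have g4 := mul_le_mul_of_nonneg_right c2 (hr0 x)
      have g5 := mul_le_mul_of_nonneg_right c1 (hr0 x')
      have g6 := mul_le_mul_of_nonneg_right c1 hR
      nlinarith)
  rw [integral_sub (delta_int K L) (delta_int K' L')] at key
  have k1 := mul_le_mul_of_nonneg_right DK hS
  have k2 := mul_le_mul_of_nonneg_right DL hR
  unfold dcov
  linarith

end stab

section fin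
variable {X Y S S' : Type*} [MeasurableSpace X] [MeasurableSpace Y]
  [MeasurableSpace S] [MeasurableSpace S'] [Fintype S] [Fintype S']
  [MeasurableSingletonClass S] [MeasurableSingletonClass S']

lemma integral_fin {Z Q : Type*} [MeasurableSpace Z] [MeasurableSpace Q] [Fintype Q]
    [MeasurableSingletonClass Q] (μ : Measure Z) [IsFiniteMeasure μ] {T : Z → Q}
    (hT : Measurable T) (f : Q → ℝ) :
    ∫ z, f (T z) ∂μ = ∑ c, μ.real (T ⁻¹' {c}) * f c := by
  rw [← integral_map (φ := T) (f := f) hT.aemeasurable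
    (measurable_of_finite f).aestronglyMeasurable, integral_fintype .of_finite]
  refine Finset.sum_congr rfl fun c _ => ?_
  rw [map_measureReal_apply hT (measurableSet_singleton c), smul_eq_mul]

lemma integral_fin2 {Z Q : Type*} [MeasurableSpace Z] [MeasurableSpace Q] [Fintype Q]
    [MeasurableSingletonClass Q] (μ : Measure Z) [IsFiniteMeasure μ] {T : Z → Q}
    (hT : Measurable T) (f : Q → Q → ℝ) :
    ∫ p : Z × Z, f (T p.1) (T p.2) ∂(μ.prod μ) =
      ∑ c, ∑ c', μ.real (T ⁻¹' {c}) * μ.real (T ⁻¹' {c'}) * f c c' := by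
  rw [integral_fin (μ.prod μ) (T := fun p : Z × Z => (T p.1, T p.2)) (by fun_prop)
    (fun q : Q × Q => f q.1 q.2), Fintype.sum_prod_type]
  refine Finset.sum_congr rfl fun c _ => Finset.sum_congr rfl fun c' _ => ?_
  rw [← measureReal_prod_prod]
  congr 2
  ext p
  simp

/-- Centred kernel for a discrete weight. -/
def polyd {Q : Type*} [Fintype Q] (u : Q → Q → ℝ) (w : Q → ℝ) (c c' : Q) : ℝ :=
  u c c' - (∑ e, w e * u c e) - (∑ e, w e * u c' e) + ∑ e, ∑ e', w e * w e' * u e e'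

/-- Distance covariance of a discrete weight. -/
def polyD {Q : Type*} [Fintype Q] (u v : Q → Q → ℝ) (w : Q → ℝ) : ℝ :=
  ∑ c, ∑ c', w c * w c' * (polyd u w c c' * polyd v w c c')

lemma polyD_cont {Q : Type*} [Fintype Q] (u v : Q → Q → ℝ) : Continuous (polyD u v) := by
  unfold polyD polyd
  fun_prop

lemma dcov_fin (θ : Measure (X × Y)) [IsFiniteMeasure θ] {p : X → S} {q : Y → S'}
    (hp : Measurable p) (hq : Measurable q) (u : S → S → ℝ) (v : S' → S' → ℝ) :
    dcov (fun x x' => u (p x) (p x')) (fun y y' => v (q y) (q y')) θ =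
      polyD (fun c c' : S × S' => u c.1 c'.1) (fun c c' => v c.2 c'.2)
        (fun c => θ.real ((fun z : X × Y => (p z.1, q z.2)) ⁻¹' {c})) := by
  set T : X × Y → S × S' := fun z => (p z.1, q z.2) with hT'
  have hT : Measurable T := by fun_prop
  have hu : Measurable (fun c : S × S => u c.1 c.2) := measurable_of_finite _
  have hv : Measurable (fun c : S' × S' => v c.1 c.2) := measurable_of_finite _
  have A1 : ∀ z : X × Y, aM (fun x x' => u (p x) (p x')) (θ.map Prod.fst) z.1 =
      ∑ e, θ.real (T ⁻¹' {e}) * u (T z).1 e.1 := by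
    intro z
    unfold aM
    refine (integral_map (by fun_prop)
      ((measurable_of_finite (u (p z.1))).comp hp).aestronglyMeasurable).trans ?_
    exact integral_fin θ hT (fun e => u (T z).1 e.1)
  have A2 : ∀ z : X × Y, aM (fun y y' => v (q y) (q y')) (θ.map Prod.snd) z.2 =
      ∑ e, θ.real (T ⁻¹' {e}) * v (T z).2 e.2 := by
    intro z
    unfold aM
    refine (integral_map (by fun_prop)
      ((measurable_of_finite (v (q z.2))).comp hq).aestronglyMeasurable).trans ?_
    exact integral_fin θ hT (fun e => v (T z).2 e.2)
  have D1 : DM (fun x x' => u (p x) (p x')) (θ.map Prod.fst) =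
      ∑ e, ∑ e', θ.real (T ⁻¹' {e}) * θ.real (T ⁻¹' {e'}) * u e.1 e'.1 := by
    unfold DM
    rw [Measure.map_prod_map θ θ measurable_fst measurable_fst]
    refine (integral_map (by fun_prop)
      (hu.comp (show Measurable fun c : X × X => (p c.1, p c.2) by fun_prop)).aestronglyMeasurable).trans ?_
    exact integral_fin2 θ hT (fun e e' => u e.1 e'.1)
  have D2 : DM (fun y y' => v (q y) (q y')) (θ.map Prod.snd) =
      ∑ e, ∑ e', θ.real (T ⁻¹' {e}) * θ.real (T ⁻¹' {e'}) * v e.2 e'.2 := by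
    unfold DM
    rw [Measure.map_prod_map θ θ measurable_snd measurable_snd]
    refine (integral_map (by fun_prop)
      (hv.comp (show Measurable fun c : Y × Y => (q c.1, q c.2) by fun_prop)).aestronglyMeasurable).trans ?_
    exact integral_fin2 θ hT (fun e e' => v e.2 e'.2)
  unfold dcov deltaTheta dM polyD
  rw [← integral_fin2 θ hT (fun c c' => _ * _)]
  refine integral_congr_ae (ae_of_all _ fun z => ?_)
  simp only [A1, A2, D1, D2, polyd, T]

end fin

lemma emp_integral {Ω 𝒵 : Type*} [MeasurableSpace 𝒵] (Z : ℕ → Ω → 𝒵) (n : ℕ) (ω : Ω)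
    {f : 𝒵 → ℝ} (hf : Measurable f) :
    ∫ z, f z ∂(emp Z n ω) = (n : ℝ)⁻¹ * ∑ k ∈ Finset.range n, f (Z k ω) := by
  unfold emp
  rw [integral_smul_measure, integral_finsetSum_measure]
  · simp [integral_dirac' f _ hf.stronglyMeasurable]
  · intro i _
    exact integrable_dirac' hf.stronglyMeasurable (by simp)

lemma emp_integrable {Ω 𝒵 : Type*} [MeasurableSpace 𝒵] (Z : ℕ → Ω → 𝒵) (n : ℕ) (hn : n ≠ 0) (ω : Ω)
    {f : 𝒵 → ℝ} (hf : Measurable f) : Integrable f (emp Z n ω) := by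
  unfold emp
  refine Integrable.smul_measure ?_ (by simp [hn])
  rw [integrable_finsetSum_measure]
  intro i _
  exact integrable_dirac' hf.stronglyMeasurable (by simp)

lemma emp_prob {Ω 𝒵 : Type*} [MeasurableSpace 𝒵] (Z : ℕ → Ω → 𝒵) (n : ℕ) (hn : n ≠ 0) (ω : Ω) :
    IsProbabilityMeasure (emp Z n ω) := by
  constructor
  simp [emp]
  exact ENNReal.inv_mul_cancel (by simp [hn]) (by simp)

/-- Finite-valued approximation of the identity. -/
def apx {X : Type*} [MetricSpace X] [TopologicalSpace.SeparableSpace X] [MeasurableSpace X]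
    [BorelSpace X] (x₀ : X) (m : ℕ) : SimpleFunc X X :=
  SimpleFunc.approxOn id measurable_id Set.univ x₀ (Set.mem_univ x₀) m

section apx
variable {X : Type*} [MetricSpace X] [TopologicalSpace.SeparableSpace X] [MeasurableSpace X]
  [BorelSpace X] (x₀ : X)

lemma apx_le (m : ℕ) (x : X) : dist (apx x₀ m x) x ≤ dist x x₀ := by
  have h := SimpleFunc.edist_approxOn_le (f := id) measurable_id (Set.mem_univ x₀) x m
  rw [edist_dist, edist_dist] at h
  have h2 := (ENNReal.ofReal_le_ofReal_iff dist_nonneg).1 h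
  rw [dist_comm x x₀]
  exact h2

lemma apx_tendsto (x : X) : Tendsto (fun m => dist (apx x₀ m x) x) atTop (𝓝 0) := by
  rw [← tendsto_iff_dist_tendsto_zero]
  exact SimpleFunc.tendsto_approxOn (f := id) measurable_id (Set.mem_univ x₀) (by simp)

lemma ker_dist [SecondCountableTopology X] {μ : Measure X}
    (h : Integrable (fun x => dist x x₀) μ) :
    Ker (fun a b : X => dist a b) (fun x => dist x x₀) μ where
  meas := measurable_dist
  nonneg _ _ := dist_nonneg
  symm := dist_comm
  tri := dist_triangle
  int := h
  le := fun x x' => dist_triangle_right x x' x₀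

lemma ker_apx [SecondCountableTopology X] {μ : Measure X}
    (h : Integrable (fun x => dist x x₀) μ) (m : ℕ) :
    Ker (fun a b : X => dist (apx x₀ m a) (apx x₀ m b)) (fun x => 2 * dist x x₀) μ where
  meas := ((apx x₀ m).measurable.comp measurable_fst).dist
    ((apx x₀ m).measurable.comp measurable_snd)
  nonneg _ _ := dist_nonneg
  symm _ _ := dist_comm _ _
  tri _ _ _ := dist_triangle _ _ _
  int := h.const_mul 2
  le := fun x x' => by
    have h1 := dist_triangle_right (apx x₀ m x) (apx x₀ m x') x₀
    have h2 := dist_triangle (apx x₀ m x) x x₀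
    have h3 := dist_triangle (apx x₀ m x') x' x₀
    have h4 := apx_le x₀ m x
    have h5 := apx_le x₀ m x'
    linarith

lemma apx_meas [SecondCountableTopology X] (m : ℕ) :
    Measurable (fun x => dist (apx x₀ m x) x) := (apx x₀ m).measurable.dist measurable_id

lemma apx_int [SecondCountableTopology X] {μ : Measure X}
    (h : Integrable (fun x => dist x x₀) μ) (m : ℕ) :
    Integrable (fun x => dist (apx x₀ m x) x) μ :=
  h.mono' (apx_meas x₀ m).aestronglyMeasurable (ae_of_all _ fun x => by
    rw [Real.norm_of_nonneg dist_nonneg]; exact apx_le x₀ m x)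

lemma apx_diff (m : ℕ) (x x' : X) :
    |dist x x' - dist (apx x₀ m x) (apx x₀ m x')| ≤ dist (apx x₀ m x) x + dist (apx x₀ m x') x' := by
  have h := dist_dist_dist_le x x' (apx x₀ m x) (apx x₀ m x')
  rw [Real.dist_eq, dist_comm x (apx x₀ m x), dist_comm x' (apx x₀ m x')] at h
  exact h

end apx

/-- Error functional. -/
def errE {X Y : Type*} [MetricSpace X] [TopologicalSpace.SeparableSpace X] [MeasurableSpace X]
    [BorelSpace X] [MetricSpace Y] [TopologicalSpace.SeparableSpace Y] [MeasurableSpace Y]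
    [BorelSpace Y] (x₀ : X) (y₀ : Y) (m : ℕ) (η : Measure (X × Y)) : ℝ :=
  32 * ((∫ z, dist z.1 x₀ ∂η) * ∫ z, dist (apx y₀ m z.2) z.2 ∂η) +
    32 * ((∫ z, 2 * dist z.2 y₀ ∂η) * ∫ z, dist (apx x₀ m z.1) z.1 ∂η)

/-- Discretised distance covariance. -/
def dcovm {X Y : Type*} [MetricSpace X] [TopologicalSpace.SeparableSpace X] [MeasurableSpace X]
    [BorelSpace X] [MetricSpace Y] [TopologicalSpace.SeparableSpace Y] [MeasurableSpace Y]
    [BorelSpace Y] (x₀ : X) (y₀ : Y) (m : ℕ) (η : Measure (X × Y)) : ℝ :=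
  dcov (fun a b : X => dist (apx x₀ m a) (apx x₀ m b))
    (fun a b : Y => dist (apx y₀ m a) (apx y₀ m b)) η

section mainsec
variable {X Y : Type*} [MetricSpace X] [TopologicalSpace.SeparableSpace X] [MeasurableSpace X]
    [BorelSpace X] [MetricSpace Y] [TopologicalSpace.SeparableSpace Y] [MeasurableSpace Y]
    [BorelSpace Y] [SecondCountableTopology X] [SecondCountableTopology Y] (x₀ : X) (y₀ : Y)

lemma dcov_dcovm (m : ℕ) (η : Measure (X × Y)) [IsProbabilityMeasure η]
    (hX : Integrable (fun x => dist x x₀) (η.map Prod.fst))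
    (hY : Integrable (fun y => dist y y₀) (η.map Prod.snd)) :
    |dcov (fun a b : X => dist a b) (fun a b : Y => dist a b) η - dcovm x₀ y₀ m η|
      ≤ errE x₀ y₀ m η :=
  dcov_stab (ker_dist x₀ hX) (ker_dist y₀ hY) (ker_apx x₀ hX m) (ker_apx y₀ hY m)
    (apx_int x₀ hX m) (apx_int y₀ hY m) (fun _ => dist_nonneg) (fun _ => dist_nonneg)
    (apx_diff x₀ m) (apx_diff y₀ m)

lemma dcovm_tendsto (m : ℕ) (η : ℕ → Measure (X × Y)) (θ : Measure (X × Y))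
    [IsProbabilityMeasure θ] (hη : ∀ᶠ n in atTop, IsProbabilityMeasure (η n))
    (h : ∀ c : (apx x₀ m).range × (apx y₀ m).range,
      Tendsto (fun n => (η n).real ({z : X × Y | apx x₀ m z.1 = c.1 ∧ apx y₀ m z.2 = c.2})) atTop
        (𝓝 (θ.real ({z : X × Y | apx x₀ m z.1 = c.1 ∧ apx y₀ m z.2 = c.2})))) :
    Tendsto (fun n => dcovm x₀ y₀ m (η n)) atTop (𝓝 (dcovm x₀ y₀ m θ)) := by
  let p : X → (apx x₀ m).range := fun x => ⟨apx x₀ m x, SimpleFunc.mem_range_self _ x⟩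
  let q : Y → (apx y₀ m).range := fun x => ⟨apx y₀ m x, SimpleFunc.mem_range_self _ x⟩
  have hp : Measurable p := (apx x₀ m).measurable.subtype_mk
  have hq : Measurable q := (apx y₀ m).measurable.subtype_mk
  have hset : ∀ c : (apx x₀ m).range × (apx y₀ m).range,
      ((fun z : X × Y => (p z.1, q z.2)) ⁻¹' {c}) =
        {z : X × Y | apx x₀ m z.1 = c.1 ∧ apx y₀ m z.2 = c.2} := by
    intro c
    ext z
    simp [p, q, Prod.ext_iff, Subtype.ext_iff]
  have E : ∀ η' : Measure (X × Y), IsProbabilityMeasure η' → dcovm x₀ y₀ m η' =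
      polyD (fun c c' : (apx x₀ m).range × (apx y₀ m).range => dist c.1 c'.1)
        (fun c c' => dist c.2 c'.2)
        (fun c => η'.real ({z : X × Y | apx x₀ m z.1 = c.1 ∧ apx y₀ m z.2 = c.2})) := by
    intro η' _
    have := dcov_fin η' hp hq (fun a b => dist a b) (fun a b => dist a b)
    simp only [hset] at this
    exact this
  rw [E θ inferInstance]
  have hc := ((polyD_cont (fun c c' : (apx x₀ m).range × (apx y₀ m).range => dist c.1 c'.1)
        (fun c c' => dist c.2 c'.2)).tendsto _).comp (tendsto_pi_nhds.2 h)
  refine hc.congr' ?_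
  filter_upwards [hη] with n hn
  exact (E _ hn).symm

lemma errE_tendsto (θ : Measure (X × Y)) [IsProbabilityMeasure θ]
    (hX : Integrable (fun x => dist x x₀) (θ.map Prod.fst))
    (hY : Integrable (fun y => dist y y₀) (θ.map Prod.snd)) :
    Tendsto (fun m => errE x₀ y₀ m θ) atTop (𝓝 0) := by
  have hX' : Integrable (fun z : X × Y => dist z.1 x₀) θ := hX.comp_measurable measurable_fst
  have hY' : Integrable (fun z : X × Y => dist z.2 y₀) θ := hY.comp_measurable measurable_snd
  have t1 : Tendsto (fun m => ∫ z : X × Y, dist (apx x₀ m z.1) z.1 ∂θ) atTop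
      (𝓝 (∫ z : X × Y, (0:ℝ) ∂θ)) := by
    refine tendsto_integral_of_dominated_convergence _
      (fun m => ((apx_meas x₀ m).comp measurable_fst).aestronglyMeasurable) hX' ?_ ?_
    · exact fun m => ae_of_all _ fun z => by
        rw [Real.norm_of_nonneg dist_nonneg]; exact apx_le x₀ m z.1
    · exact ae_of_all _ fun z => apx_tendsto x₀ z.1
  have t2 : Tendsto (fun m => ∫ z : X × Y, dist (apx y₀ m z.2) z.2 ∂θ) atTop
      (𝓝 (∫ z : X × Y, (0:ℝ) ∂θ)) := by
    refine tendsto_integral_of_dominated_convergence _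
      (fun m => ((apx_meas y₀ m).comp measurable_snd).aestronglyMeasurable) hY' ?_ ?_
    · exact fun m => ae_of_all _ fun z => by
        rw [Real.norm_of_nonneg dist_nonneg]; exact apx_le y₀ m z.2
    · exact ae_of_all _ fun z => apx_tendsto y₀ z.2
  have := ((t2.const_mul (∫ z : X × Y, dist z.1 x₀ ∂θ)).const_mul 32).add
    ((t1.const_mul (∫ z : X × Y, 2 * dist z.2 y₀ ∂θ)).const_mul 32)
  simpa [errE] using this

end mainsec

lemma shift_iterate {𝒵 : Type*} (k : ℕ) : ∀ x : ℕ → 𝒵, shift^[k] x 0 = x k := by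
  suffices ∀ x : ℕ → 𝒵, ∀ i, shift^[k] x i = x (i + k) by intro x; simpa using this x 0
  induction k with
  | zero => intro x i; rfl
  | succ k ih =>
    intro x i
    rw [Function.iterate_succ_apply, ih, shift]
    congr 1

lemma emp_slln {𝒵 Ω : Type*} [MeasurableSpace 𝒵] [MeasurableSpace Ω] (P : Measure Ω)
    [IsProbabilityMeasure P] (Z : ℕ → Ω → 𝒵) (hZmeas : ∀ i, Measurable (Z i))
    (herg : Ergodic shift (P.map fun ω i => Z i ω))
    {f : 𝒵 → ℝ} (hf : Measurable f) (hfi : Integrable f (P.map (Z 0))) :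
    ∀ᵐ ω ∂P, Tendsto (fun n => ∫ z, f z ∂(emp Z n ω)) atTop (𝓝 (∫ z, f z ∂(P.map (Z 0)))) := by
  have hm : Measurable (fun ω i => Z i ω) := measurable_pi_lambda _ hZmeas
  have : IsProbabilityMeasure (P.map fun ω i => Z i ω) :=
    Measure.isProbabilityMeasure_map hm.aemeasurable
  have hg : Measurable (fun x : ℕ → 𝒵 => f (x 0)) := hf.comp (measurable_pi_apply 0)
  have hgi : Integrable (fun x : ℕ → 𝒵 => f (x 0)) (P.map fun ω i => Z i ω) := by
    rw [integrable_map_measure hg.aestronglyMeasurable hm.aemeasurable]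
    exact hfi.comp_measurable (hZmeas 0)
  have hI : ∫ x, f (x 0) ∂(P.map fun ω i => Z i ω) = ∫ z, f z ∂(P.map (Z 0)) := by
    rw [integral_map hm.aemeasurable hg.aestronglyMeasurable,
      integral_map (hZmeas 0).aemeasurable hf.aestronglyMeasurable]
  have hB := ae_of_ae_map hm.aemeasurable (birkhoff_ergodic herg hg hgi)
  rw [hI] at hB
  filter_upwards [hB] with ω hω
  refine hω.congr fun n => ?_
  rw [emp_integral Z n ω hf]
  simp [birkhoffSum, shift_iterate]

/-- For random variables `X, Y` in separable metric spaces with finite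
first moments and a strictly stationary ergodic sequence `(Z_k)` with `L(Z₁) = θ`, the
empirical distance covariance `dcov(θₙ)` converges almost surely to `dcov(θ)`. -/
theorem dcov_ergodic_strong_consistency
    {X Y : Type*}
    [MetricSpace X] [TopologicalSpace.SeparableSpace X] [MeasurableSpace X] [BorelSpace X]
    [MetricSpace Y] [TopologicalSpace.SeparableSpace Y] [MeasurableSpace Y] [BorelSpace Y]
    {Ω : Type*} [MeasurableSpace Ω] (P : Measure Ω) [IsProbabilityMeasure P]
    (Z : ℕ → Ω → X × Y) (hZmeas : ∀ i, Measurable (Z i))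
    -- strict stationarity and ergodicity of the process
    (hstat : MeasurePreserving shift (P.map fun ω i => Z i ω) (P.map fun ω i => Z i ω))
    (herg : Ergodic shift (P.map fun ω i => Z i ω))
    (θ : Measure (X × Y)) (hθ : θ = P.map (Z 0))
    -- finite first moments
    (x₀ : X) (y₀ : Y)
    (hmomX : Integrable (fun x => dist x x₀) (θ.map Prod.fst))
    (hmomY : Integrable (fun y => dist y y₀) (θ.map Prod.snd)) :
    ∀ᵐ ω ∂P, Tendsto
      (fun n => dcov (fun a b : X => dist a b) (fun a b : Y => dist a b) (emp Z n ω))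
      atTop (𝓝 (dcov (fun a b : X => dist a b) (fun a b : Y => dist a b) θ)) := by
  have : SecondCountableTopology X := UniformSpace.secondCountable_of_separable X
  have : SecondCountableTopology Y := UniformSpace.secondCountable_of_separable Y
  have hθp : IsProbabilityMeasure θ := by
    rw [hθ]; exact Measure.isProbabilityMeasure_map (hZmeas 0).aemeasurable
  have slln : ∀ f : X × Y → ℝ, Measurable f → Integrable f θ →
      ∀ᵐ ω ∂P, Tendsto (fun n => ∫ z, f z ∂(emp Z n ω)) atTop (𝓝 (∫ z, f z ∂θ)) := by
    rw [hθ]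
    intro f hf hfi
    exact emp_slln P Z hZmeas herg hf hfi
  have hX' : Integrable (fun z : X × Y => dist z.1 x₀) θ := hmomX.comp_measurable measurable_fst
  have hY' : Integrable (fun z : X × Y => dist z.2 y₀) θ := hmomY.comp_measurable measurable_snd
  have s1 := slln (fun z => dist z.1 x₀) (by fun_prop) hX'
  have s2 := slln (fun z => 2 * dist z.2 y₀) (by fun_prop) (hY'.const_mul 2)
  have s3 : ∀ᵐ ω ∂P, ∀ m, Tendsto (fun n => ∫ z, dist (apx x₀ m z.1) z.1 ∂(emp Z n ω)) atTop
      (𝓝 (∫ z, dist (apx x₀ m z.1) z.1 ∂θ)) := ae_all_iff.2 fun m =>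
    slln (fun z => dist (apx x₀ m z.1) z.1) ((apx_meas x₀ m).comp measurable_fst)
      ((apx_int x₀ hmomX m).comp_measurable measurable_fst)
  have s4 : ∀ᵐ ω ∂P, ∀ m, Tendsto (fun n => ∫ z, dist (apx y₀ m z.2) z.2 ∂(emp Z n ω)) atTop
      (𝓝 (∫ z, dist (apx y₀ m z.2) z.2 ∂θ)) := ae_all_iff.2 fun m =>
    slln (fun z => dist (apx y₀ m z.2) z.2) ((apx_meas y₀ m).comp measurable_snd)
      ((apx_int y₀ hmomY m).comp_measurable measurable_snd)
  have s5 : ∀ᵐ ω ∂P, ∀ m, ∀ c : (apx x₀ m).range × (apx y₀ m).range,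
      Tendsto (fun n => (emp Z n ω).real
        ({z : X × Y | apx x₀ m z.1 = c.1 ∧ apx y₀ m z.2 = c.2})) atTop
        (𝓝 (θ.real ({z : X × Y | apx x₀ m z.1 = c.1 ∧ apx y₀ m z.2 = c.2}))) := by
    refine ae_all_iff.2 fun m => ae_all_iff.2 fun c => ?_
    have hms : MeasurableSet {z : X × Y | apx x₀ m z.1 = c.1 ∧ apx y₀ m z.2 = c.2} := by
      have e1 : MeasurableSet ((fun z : X × Y => apx x₀ m z.1) ⁻¹' {(c.1 : X)}) :=
        ((apx x₀ m).measurable.comp measurable_fst) (measurableSet_singleton _)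
      have e2 : MeasurableSet ((fun z : X × Y => apx y₀ m z.2) ⁻¹' {(c.2 : Y)}) :=
        ((apx y₀ m).measurable.comp measurable_snd) (measurableSet_singleton _)
      exact e1.inter e2
    have := slln (Set.indicator {z : X × Y | apx x₀ m z.1 = c.1 ∧ apx y₀ m z.2 = c.2} 1)
      (measurable_one.indicator hms) ((integrable_const (1:ℝ)).indicator hms)
    simpa only [integral_indicator_one hms] using this
  filter_upwards [s1, s2, s3, s4, s5] with ω h1 h2 h3 h4 h5
  have hpr : ∀ᶠ n in atTop, IsProbabilityMeasure (emp Z n ω) := by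
    filter_upwards [eventually_ge_atTop 1] with n hn
    exact emp_prob Z n (by omega) ω
  have tE : ∀ m, Tendsto (fun n => errE x₀ y₀ m (emp Z n ω)) atTop (𝓝 (errE x₀ y₀ m θ)) :=
    fun m => ((h1.mul (h4 m)).const_mul 32).add ((h2.mul (h3 m)).const_mul 32)
  have tD : ∀ m, Tendsto (fun n => dcovm x₀ y₀ m (emp Z n ω)) atTop (𝓝 (dcovm x₀ y₀ m θ)) :=
    fun m => dcovm_tendsto x₀ y₀ m (fun n => emp Z n ω) θ hpr (h5 m)
  rw [Metric.tendsto_nhds]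
  intro ε hε
  have hε4 : 0 < ε / 4 := by linarith
  obtain ⟨m, hm⟩ := ((errE_tendsto x₀ y₀ θ hmomX hmomY).eventually_lt_const hε4).exists
  filter_upwards [(tE m).eventually_lt_const hm, Metric.tendsto_nhds.1 (tD m) (ε / 4) hε4, hpr,
    eventually_ge_atTop 1] with n g1 g2 g3 g4
  have iX : Integrable (fun x => dist x x₀) ((emp Z n ω).map Prod.fst) := by
    rw [integrable_map_measure (by fun_prop) (by fun_prop)]
    exact emp_integrable Z n (by omega) ω (by fun_prop)
  have iY : Integrable (fun y => dist y y₀) ((emp Z n ω).map Prod.snd) := by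
    rw [integrable_map_measure (by fun_prop) (by fun_prop)]
    exact emp_integrable Z n (by omega) ω (by fun_prop)
  have a1 := abs_le.1 (dcov_dcovm x₀ y₀ m (emp Z n ω) iX iY)
  have a2 := abs_le.1 (dcov_dcovm x₀ y₀ m θ hmomX hmomY)
  rw [Real.dist_eq, abs_lt] at g2 ⊢
  constructor <;> linarith
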